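/- Let P ∈ ℝ^{n×n} be row-stochastic. Then P has n-1 eigenvalues (counted with multiplicity) with real part strictly less than 1 if and only if the directed graph associated with P contains a directed spanning tree. -/

import Mathlib

open Matrix

lemma aux_root_max {n : ℕ} (P : Matrix (Fin n) (Fin n) ℝ)
    (hP : ∀ i j, 0 ≤ P i j) (hrow : ∀ i, ∑ j, P i j = 1) (root : Fin n)
    (hroot : ∀ j, Relation.ReflTransGen (fun x y => 0 < P y x) root j)
    (v : Fin n → ℝ) (hv : P *ᵥ v = v) (j : Fin n) : v j ≤ v root := by
  have : Nonempty (Fin n) := ⟨root⟩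
  obtain ⟨m, hm⟩ := Finite.exists_max v
  suffices h : v root = v m by rw [h]; exact hm j
  refine Relation.ReflTransGen.head_induction_on
    (motive := fun a _ => v a = v m) (hroot m) rfl ?_
  intro a c hac _ hc
  have h0 : ∑ i, P c i * (v m - v i) = 0 := by
    have h1 : ∑ i, P c i * v i = v c := congrFun hv c
    simp only [mul_sub, Finset.sum_sub_distrib, ← Finset.sum_mul, hrow, h1, hc]
    ring
  have h2 := (Finset.sum_eq_zero_iff_of_nonneg
    (fun i _ => mul_nonneg (hP c i) (sub_nonneg.2 (hm i)))).1 h0 a (Finset.mem_univ _)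
  rcases mul_eq_zero.1 h2 with h3 | h3
  · exact absurd h3 hac.ne'
  · linarith

lemma aux_root_const {n : ℕ} (P : Matrix (Fin n) (Fin n) ℝ)
    (hP : ∀ i j, 0 ≤ P i j) (hrow : ∀ i, ∑ j, P i j = 1) (root : Fin n)
    (hroot : ∀ j, Relation.ReflTransGen (fun x y => 0 < P y x) root j)
    (v : Fin n → ℝ) (hv : P *ᵥ v = v) (j : Fin n) : v j = v root := by
  have h1 := aux_root_max P hP hrow root hroot v hv j
  have h2 := aux_root_max P hP hrow root hroot (-v) (by rw [mulVec_neg, hv]) j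
  simp only [Pi.neg_apply] at h2
  linarith

lemma aux_shift_le {n : ℕ} (hn : 0 < n) (P : Matrix (Fin n) (Fin n) ℝ)
    (hP : ∀ i j, 0 ≤ P i j) (hrow : ∀ i, ∑ j, P i j = 1)
    (v : Fin n → ℝ) (c : ℝ) (hv : ∀ j, (P *ᵥ v) j - v j = c) : c ≤ 0 := by
  have : Nonempty (Fin n) := ⟨⟨0, hn⟩⟩
  obtain ⟨m, hm⟩ := Finite.exists_max v
  have h1 : (P *ᵥ v) m ≤ v m := by
    calc (P *ᵥ v) m = ∑ i, P m i * v i := rfl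
      _ ≤ ∑ i, P m i * v m :=
        Finset.sum_le_sum fun i _ => mul_le_mul_of_nonneg_left (hm i) (hP m i)
      _ = v m := by rw [← Finset.sum_mul, hrow, one_mul]
  linarith [hv m]

lemma aux_gen_const {n : ℕ} (hn : 0 < n) (P : Matrix (Fin n) (Fin n) ℝ)
    (hP : ∀ i j, 0 ≤ P i j) (hrow : ∀ i, ∑ j, P i j = 1) (root : Fin n)
    (hroot : ∀ j, Relation.ReflTransGen (fun x y => 0 < P y x) root j) (k : ℕ) :
    ∀ v : Fin n → ℝ, ((toLin' P - (1 : ℝ) • (1 : Module.End ℝ (Fin n → ℝ))) ^ k) v = 0 →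
      ∀ j, v j = v root := by
  induction k with
  | zero => intro v hv j; simp at hv; simp [hv]
  | succ k ih =>
    intro v hv
    rw [pow_succ, Module.End.mul_apply] at hv
    have h1 := ih _ hv
    simp only [one_smul, LinearMap.sub_apply, toLin'_apply, Module.End.one_apply,
      Pi.sub_apply] at h1
    have hc1 := aux_shift_le hn P hP hrow v _ h1
    have hc2 := aux_shift_le hn P hP hrow (-v) (-((P *ᵥ v) root - v root)) (by
      intro j
      rw [mulVec_neg, ← h1 j]; simp only [Pi.neg_apply]; ring)
    apply aux_root_const P hP hrow root hroot
    ext j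
    linarith [h1 j]

lemma aux_left_fixed {n : ℕ} (P : Matrix (Fin n) (Fin n) ℝ)
    (hP : ∀ i j, 0 ≤ P i j) (hrow : ∀ i, ∑ j, P i j = 1) (C : Set (Fin n)) (a : Fin n)
    (ha : a ∈ C) (hC : ∀ j ∈ C, ∀ i, 0 < P j i → i ∈ C) :
    ∃ w : Fin n → ℝ, w ≠ 0 ∧ (∀ i, i ∉ C → w i = 0) ∧ Pᵀ *ᵥ w = w := by
  classical
  have hz : ∀ j ∈ C, ∀ i, i ∉ C → P j i = 0 := fun j hj i hi =>
    le_antisymm (not_lt.1 fun h => hi (hC j hj i h)) (hP j i)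
  have key : ∀ f : Fin n → ℝ, (∀ i, i ∉ C → f i = 0) → ∑ i : C, f i = ∑ i, f i := by
    intro f hf
    rw [← Finset.sum_subtype (Finset.univ.filter (· ∈ C)) (by simp) f, Finset.sum_filter]
    exact Finset.sum_congr rfl fun i _ => by by_cases h : i ∈ C <;> simp [h, hf]
  let Q : Matrix C C ℝ := P.submatrix (↑) (↑)
  have hdet : (Q - 1).det = 0 := by
    rw [← exists_mulVec_eq_zero_iff]
    refine ⟨fun _ => 1, fun h => one_ne_zero (congrFun h ⟨a, ha⟩), ?_⟩
    ext j
    rw [sub_mulVec, one_mulVec]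
    have := key (P j) (hz j j.2)
    simp [mulVec, dotProduct, Q, this, hrow]
  obtain ⟨u, hu, huQ⟩ := exists_vecMul_eq_zero_iff.2 hdet
  rw [vecMul_sub, vecMul_one, sub_eq_zero] at huQ
  let w : Fin n → ℝ := fun i => if h : i ∈ C then u ⟨i, h⟩ else 0
  have hwC : ∀ i : C, w i = u i := fun i => by simp [w]
  have hw0 : ∀ i, i ∉ C → w i = 0 := fun i hi => by simp [w, hi]
  refine ⟨w, ?_, hw0, ?_⟩
  · intro h
    apply hu
    ext i
    rw [← hwC, h]; rfl
  · ext i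
    have h1 : (Pᵀ *ᵥ w) i = ∑ j : C, P j i * u j := by
      have := key (fun j => P j i * w j) (fun j hj => by simp [hw0 j hj])
      simp only [hwC] at this
      rw [this]; rfl
    rw [h1]
    by_cases hi : i ∈ C
    · have h2 := congrFun huQ ⟨i, hi⟩
      rw [hwC ⟨i, hi⟩, ← h2]
      simp [vecMul, dotProduct, Q, mul_comm]
    · rw [hw0 i hi]
      exact Finset.sum_eq_zero fun j _ => by rw [hz j j.2 i hi, zero_mul]

lemma aux_eig {n : ℕ} (P : Matrix (Fin n) (Fin n) ℝ)
    (hP : ∀ i j, 0 ≤ P i j) (hrow : ∀ i, ∑ j, P i j = 1) (μ : ℂ)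
    (hμ : μ ∈ (P.map Complex.ofReal).charpoly.roots) (h1 : ¬ μ.re < 1) : μ = 1 := by
  have he : Module.End.HasEigenvalue (toLin' (P.map Complex.ofReal)) μ := by
    rw [Module.End.hasEigenvalue_iff_isRoot_charpoly, charpoly_toLin']
    exact Polynomial.isRoot_of_mem_roots hμ
  obtain ⟨k, hk⟩ := eigenvalue_mem_ball he
  have hs : ∑ j ∈ Finset.univ.erase k, ‖(P.map Complex.ofReal) k j‖ = 1 - P k k := by
    have h2 := Finset.add_sum_erase Finset.univ (P k) (Finset.mem_univ k)
    rw [hrow] at h2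
    rw [← h2, add_sub_cancel_left]
    refine Finset.sum_congr rfl fun j _ => ?_
    simp [abs_of_nonneg (hP k j)]
  rw [hs, mem_closedBall_iff_norm, map_apply] at hk
  have hpos : 0 ≤ 1 - P k k := (norm_nonneg _).trans hk
  have hsq : ‖μ - (P k k : ℂ)‖ ^ 2 ≤ (1 - P k k) ^ 2 := by gcongr
  rw [Complex.sq_norm, Complex.normSq_apply] at hsq
  simp only [Complex.sub_re, Complex.sub_im, Complex.ofReal_re, Complex.ofReal_im, sub_zero]
    at hsq
  push Not at h1
  have him : μ.im = 0 := by nlinarith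
  have hre : μ.re = 1 := by
    rw [him] at hsq
    nlinarith
  exact Complex.ext (by simpa using hre) (by simpa using him)

lemma aux_card {n : ℕ} (hn : 0 < n) (P : Matrix (Fin n) (Fin n) ℝ)
    (hP : ∀ i j, 0 ≤ P i j) (hrow : ∀ i, ∑ j, P i j = 1) :
    (Multiset.card
        (((P.map Complex.ofReal).charpoly.roots).filter (fun μ => μ.re < 1)) = n - 1)
      ↔ P.charpoly.rootMultiplicity 1 = 1 := by
  classical
  have h1 := congrArg Multiset.card (Multiset.filter_add_not (fun μ : ℂ => μ.re < 1)
    (P.map Complex.ofReal).charpoly.roots)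
  rw [Multiset.card_add, IsAlgClosed.card_roots_eq_natDegree, charpoly_natDegree_eq_dim,
    Fintype.card_fin] at h1
  have h2 : (P.map Complex.ofReal).charpoly.roots.filter (fun μ => ¬ μ.re < 1)
      = (P.map Complex.ofReal).charpoly.roots.filter (fun μ => (1 : ℂ) = μ) := by
    apply Multiset.filter_congr
    intro μ hμ
    exact ⟨fun h => (aux_eig P hP hrow μ hμ h).symm, fun h => by simp [← h]⟩
  have h3 : (P.map Complex.ofReal).charpoly = P.charpoly.map Complex.ofRealHom :=
    charpoly_map P Complex.ofRealHom
  have h4 := Polynomial.eq_rootMultiplicity_map (p := P.charpoly) (f := Complex.ofRealHom)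
    Complex.ofReal_injective 1
  rw [map_one, ← h3] at h4
  rw [h2, ← Multiset.count_eq_card_filter_eq, Polynomial.count_roots, ← h4] at h1
  omega

theorem stmt14 {n : ℕ} (hn : 0 < n) (P : Matrix (Fin n) (Fin n) ℝ)
    (hP : ∀ i j, 0 ≤ P i j) (hrow : ∀ i, ∑ j, P i j = 1) :
    (Multiset.card
        (((P.map Complex.ofReal).charpoly.roots).filter (fun μ => μ.re < 1)) = n - 1)
      ↔ ∃ root : Fin n, ∀ j, Relation.ReflTransGen (fun x y => 0 < P y x) root j := by
  classical
  rw [aux_card hn P hP hrow]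
  constructor
  · intro h
    by_contra hno
    push Not at hno
    let r : Fin n → Fin n → Prop := Relation.ReflTransGen (fun x y => 0 < P y x)
    let R : Fin n → Finset (Fin n) := fun j => Finset.univ.filter (fun i => r i j)
    have : Nonempty (Fin n) := ⟨⟨0, hn⟩⟩
    obtain ⟨j, hj⟩ := Finite.exists_min (fun j => (R j).card)
    obtain ⟨k, hk⟩ := hno j
    have hsub : ∀ i, r i j → r j i := by
      intro i hi
      have hss : R i ⊆ R j := fun x hx => by
        simp only [R, Finset.mem_filter, Finset.mem_univ, true_and] at hx ⊢
        exact hx.trans hi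
      have heq := Finset.eq_of_subset_of_card_le hss (hj i)
      have : j ∈ R j := by simp [R, r, Relation.ReflTransGen.refl]
      rw [← heq] at this
      simpa [R] using this
    have hclosed : ∀ l, ∀ x ∈ {i | r i l}, ∀ y, 0 < P x y → y ∈ {i | r i l} :=
      fun l x hx y hxy => Relation.ReflTransGen.head hxy hx
    obtain ⟨w₁, h1n, h1s, h1f⟩ := aux_left_fixed P hP hrow {i | r i j} j
      Relation.ReflTransGen.refl (hclosed j)
    obtain ⟨w₂, h2n, h2s, h2f⟩ := aux_left_fixed P hP hrow {i | r i k} k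
      Relation.ReflTransGen.refl (hclosed k)
    have hle := LinearMap.finrank_eigenspace_le (toLin' Pᵀ) (1 : ℝ)
    rw [charpoly_toLin', charpoly_transpose, h] at hle
    have m1 : w₁ ∈ Module.End.eigenspace (toLin' Pᵀ) (1 : ℝ) := by
      rw [Module.End.mem_eigenspace_iff, toLin'_apply, h1f, one_smul]
    have m2 : w₂ ∈ Module.End.eigenspace (toLin' Pᵀ) (1 : ℝ) := by
      rw [Module.End.mem_eigenspace_iff, toLin'_apply, h2f, one_smul]
    obtain ⟨u, hu⟩ := finrank_le_one_iff.1 hle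
    obtain ⟨c, hc⟩ := hu ⟨w₁, m1⟩
    obtain ⟨d, hd⟩ := hu ⟨w₂, m2⟩
    have hc' : ∀ i, c * u.1 i = w₁ i := fun i => congrFun (congrArg Subtype.val hc) i
    have hd' : ∀ i, d * u.1 i = w₂ i := fun i => congrFun (congrArg Subtype.val hd) i
    obtain ⟨i, hi⟩ := Function.ne_iff.1 h1n
    have hij : r i j := by
      by_contra hcon
      exact hi (h1s i hcon)
    have hw2i : w₂ i = 0 := h2s i fun hik => hk ((hsub i hij).trans hik)
    have hui : u.1 i ≠ 0 := by
      intro h0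
      apply hi
      rw [← hc', h0, mul_zero]; rfl
    have hd0 : d = 0 := by
      have := hd' i
      rw [hw2i] at this
      exact (mul_eq_zero.1 this).resolve_right hui
    apply h2n
    ext x
    rw [← hd', hd0, zero_mul]; rfl
  · rintro ⟨root, hroot⟩
    rw [← charpoly_toLin', ← LinearMap.finrank_maxGenEigenspace_eq]
    have h1 : (fun _ => 1 : Fin n → ℝ) ∈ Module.End.maxGenEigenspace (toLin' P) (1 : ℝ) := by
      rw [Module.End.mem_maxGenEigenspace]
      refine ⟨1, ?_⟩
      ext i
      simp [mulVec, dotProduct, hrow]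
    rw [finrank_eq_one_iff_of_nonzero' (⟨_, h1⟩ : Module.End.maxGenEigenspace (toLin' P) (1 : ℝ))
      (fun h => one_ne_zero (congrFun (congrArg Subtype.val h) root))]
    rintro ⟨w, hw⟩
    obtain ⟨k, hk⟩ := (Module.End.mem_maxGenEigenspace _ _ _).1 hw
    refine ⟨w root, Subtype.ext ?_⟩
    ext i
    have hi := aux_gen_const hn P hP hrow root hroot k w hk i
    simp [hi]
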